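/- arXiv:1712.05871 — 5 statements merged into one kernel-verified Lean document; each statement's English description precedes it below -/
import Mathlib

section
/- Restriction property of compensated convex transforms: Let n, m ≥ 1 and let f : ℝ^n → ℝ be bounded, with |f(x)| ≤ M for some M > 0 and all x ∈ ℝ^n. Define g^M, g^{−M} : ℝ^n × ℝ^m → ℝ by g^M(x,y) = f(x) if y = 0 and g^M(x,y) = M if y ≠ 0, and g^{−M}(x,y) = f(x) if y = 0 and g^{−M}(x,y) = −M if y ≠ 0. Then for every λ > 0 and every x ∈ ℝ^n, C^l_λ(g^M)(x,0) = C^l_λ(f)(x) and C^u_λ(g^{−M})(x,0) = C^u_λ(f)(x), where the transforms on the left are computed in ℝ^{n+m} and those on the right in ℝ^n. -/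
open Metric Set

variable {E : Type*}

/-- Convex envelope of `g`: the pointwise supremum of all affine functions lying below `g`. -/
noncomputable def convEnv [NormedAddCommGroup E] [NormedSpace ℝ E]
    (g : E → ℝ) (x : E) : ℝ :=
  sSup {v : ℝ | ∃ l : E →ᵃ[ℝ] ℝ, (∀ y, l y ≤ g y) ∧ v = l x}

/-- Lower compensated convex transform `C^l_λ(f)`. -/
noncomputable def lowerTransform [NormedAddCommGroup E] [NormedSpace ℝ E]
    (lam : ℝ) (f : E → ℝ) (x : E) : ℝ :=
  convEnv (fun y => lam * ‖y‖ ^ 2 + f y) x - lam * ‖x‖ ^ 2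

/-- Upper compensated convex transform `C^u_λ(f)`. -/
noncomputable def upperTransform [NormedAddCommGroup E] [NormedSpace ℝ E]
    (lam : ℝ) (f : E → ℝ) (x : E) : ℝ :=
  lam * ‖x‖ ^ 2 - convEnv (fun y => lam * ‖y‖ ^ 2 - f y) x

open Classical in
/-- `extendBy f K M` is the function equal to `f` on `K` and to the constant `M` off `K`. -/
noncomputable def extendBy (f : E → ℝ) (K : Set E) (M : ℝ) (x : E) : ℝ :=
  if x ∈ K then f x else M

/-- Average compensated convex approximation `A^M_λ(f_K)`. -/
noncomputable def avgApprox [NormedAddCommGroup E] [NormedSpace ℝ E]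
    (lam M : ℝ) (f : E → ℝ) (K : Set E) (x : E) : ℝ :=
  (lowerTransform lam (extendBy f K M) x + upperTransform lam (extendBy f K (-M)) x) / 2

/-- The affine minorants of `lam * ‖·‖ ^ 2 + g` and of `lam * ‖·‖ ^ 2 + f` take the same values on
the slice `y = 0`, when `f ≤ M` and `g` extends `f` by `M`. -/
theorem lowerTransform_toLp_zero {F G : Type*} [NormedAddCommGroup F] [InnerProductSpace ℝ F]
    [NormedAddCommGroup G] [InnerProductSpace ℝ G] {f : F → ℝ} {M lam : ℝ} (hf : ∀ x, f x ≤ M)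
    (hlam : 0 ≤ lam) {g : WithLp 2 (F × G) → ℝ} (hg0 : ∀ x, g (WithLp.toLp 2 (x, 0)) = f x)
    (hg1 : ∀ x y, y ≠ 0 → g (WithLp.toLp 2 (x, y)) = M) (x : F) :
    lowerTransform lam g (WithLp.toLp 2 (x, 0)) = lowerTransform lam f x := by
  have hnorm (x : F) (y : G) : ‖WithLp.toLp 2 (x, y)‖ ^ 2 = ‖x‖ ^ 2 + ‖y‖ ^ 2 :=
    WithLp.prod_norm_sq_eq_of_L2 _
  let e := WithLp.linearEquiv 2 ℝ (F × G)
  unfold lowerTransform convEnv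
  congr 2
  · ext v
    constructor
    · rintro ⟨l, hl, rfl⟩
      refine ⟨l.comp (e.symm.toLinearMap ∘ₗ LinearMap.inl ℝ F G).toAffineMap, fun y => ?_, rfl⟩
      have h := hl (WithLp.toLp 2 (y, 0))
      beta_reduce at h
      rw [hnorm, hg0] at h
      simpa [e] using h
    · rintro ⟨l, hl, rfl⟩
      refine ⟨l.comp (LinearMap.fst ℝ F G ∘ₗ e.toLinearMap).toAffineMap, fun z => ?_, rfl⟩
      obtain ⟨x, y⟩ := z
      change l x ≤ lam * ‖WithLp.toLp 2 (x, y)‖ ^ 2 + g (WithLp.toLp 2 (x, y))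
      rw [hnorm]
      by_cases hy : y = 0
      · subst hy
        simpa [hg0] using hl x
      · rw [hg1 x y hy]
        nlinarith [hl x, hf x, mul_nonneg hlam (sq_nonneg ‖y‖)]
  · rw [hnorm]
    simp

theorem upperTransform_eq_neg_lowerTransform [NormedAddCommGroup E] [NormedSpace ℝ E]
    (lam : ℝ) (f : E → ℝ) (x : E) :
    upperTransform lam f x = -lowerTransform lam (-f) x := by
  simp [upperTransform, lowerTransform, sub_eq_add_neg, add_comm]

/-- **Restriction property of compensated convex transforms.**
If `f : ℝ^n → ℝ` is bounded by `M > 0` and `g^M, g^{-M} : ℝ^n × ℝ^m → ℝ` are defined by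
`g^{±M}(x,y) = f(x)` if `y = 0` and `±M` otherwise, then for every `λ > 0` and every `x`,
`C^l_λ(g^M)(x,0) = C^l_λ(f)(x)` and `C^u_λ(g^{-M})(x,0) = C^u_λ(f)(x)`, where the transforms on
the left are computed in `ℝ^{n+m}` (with the Euclidean product norm). -/
theorem restriction_property {n m : ℕ} (hn : 1 ≤ n) (hm : 1 ≤ m)
    (f : EuclideanSpace ℝ (Fin n) → ℝ) (M : ℝ) (hMpos : 0 < M)
    (hfbd : ∀ x, |f x| ≤ M)
    (gP gN : WithLp 2 (EuclideanSpace ℝ (Fin n) × EuclideanSpace ℝ (Fin m)) → ℝ)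
    (hgP0 : ∀ x : EuclideanSpace ℝ (Fin n),
      gP ((WithLp.equiv 2 (EuclideanSpace ℝ (Fin n) × EuclideanSpace ℝ (Fin m))).symm (x, 0)) = f x)
    (hgP1 : ∀ (x : EuclideanSpace ℝ (Fin n)) (y : EuclideanSpace ℝ (Fin m)), y ≠ 0 →
      gP ((WithLp.equiv 2 (EuclideanSpace ℝ (Fin n) × EuclideanSpace ℝ (Fin m))).symm (x, y)) = M)
    (hgN0 : ∀ x : EuclideanSpace ℝ (Fin n),
      gN ((WithLp.equiv 2 (EuclideanSpace ℝ (Fin n) × EuclideanSpace ℝ (Fin m))).symm (x, 0)) = f x)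
    (hgN1 : ∀ (x : EuclideanSpace ℝ (Fin n)) (y : EuclideanSpace ℝ (Fin m)), y ≠ 0 →
      gN ((WithLp.equiv 2 (EuclideanSpace ℝ (Fin n) × EuclideanSpace ℝ (Fin m))).symm (x, y)) = -M)
    (lam : ℝ) (hlam : 0 < lam) (x : EuclideanSpace ℝ (Fin n)) :
    lowerTransform lam gP
        ((WithLp.equiv 2 (EuclideanSpace ℝ (Fin n) × EuclideanSpace ℝ (Fin m))).symm (x, 0)) =
      lowerTransform lam f x ∧
    upperTransform lam gN
        ((WithLp.equiv 2 (EuclideanSpace ℝ (Fin n) × EuclideanSpace ℝ (Fin m))).symm (x, 0)) =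
      upperTransform lam f x := by
  refine ⟨lowerTransform_toLp_zero (fun x => (abs_le.1 (hfbd x)).2) hlam.le hgP0 hgP1 x, ?_⟩
  rw [upperTransform_eq_neg_lowerTransform, upperTransform_eq_neg_lowerTransform, neg_inj]
  exact lowerTransform_toLp_zero (M := M) (fun x => neg_le.1 (abs_le.1 (hfbd x)).1) hlam.le
    (fun x => congrArg Neg.neg (hgN0 x))
    (fun x y hy => (congrArg Neg.neg (hgN1 x y hy)).trans (neg_neg M)) x
end

section
/- Error estimate for level-set approximation (Lipschitz case): Suppose f : ℝ^n → ℝ is continuous, m ≥ 1, a_0 < a_1 < ⋯ < a_m, and the sublevel sets V_{a_i} = {x : f(x) ≤ a_i} are nonempty and compact for all i. Let Γ_{a_i} = {x : f(x) = a_i}, K = ∪_{i=0}^m Γ_{a_i}, and for 0 ≤ i ≤ m−1 let Ω_i = {x : a_i < f(x) < a_{i+1}} and, for x ∈ Ω_i, d_i(x) = inf over unit vectors ν of (d_ν^+(x) + d_ν^−(x)), where d_ν^+(x) = sup{t > 0 : x + sν ∈ Ω_i for all 0 ≤ s ≤ t} and d_ν^−(x) = sup{t > 0 : x − sν ∈ Ω_i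 for all 0 ≤ s ≤ t}. Let R > 0 be such that V_{a_m} ⊂ B(0,R), and let f̃ : ℝ^n → ℝ be a Lipschitz function with Lipschitz constant L̃ > 0 such that f̃ = f on V_{a_m}, f̃ = a_m + 1 on ℝ^n ∖ B(0,R), and |f̃| ≤ Ã_0 on ℝ^n. If λ > a_m − a_0 + 1 and M > Ã_0 + λ(2R+1)², then for every i ∈ {0,…,m−1} and every x ∈ Ω_i, |A^M_λ(f_K)(x) − f(x)| ≤ L̃ d_i(x) + L̃²/λ. -/
open Metric Set

variable {E : Type*}

/-- `dPlus Q x ν`: supremum of `t > 0` such that the segment `x + [0,t]ν` stays in `Q`. -/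
noncomputable def dPlus [NormedAddCommGroup E] [NormedSpace ℝ E]
    (Q : Set E) (x ν : E) : ℝ :=
  sSup {t : ℝ | 0 < t ∧ ∀ s : ℝ, 0 ≤ s → s ≤ t → x + s • ν ∈ Q}

/-- `dMinus Q x ν`: supremum of `t > 0` such that the segment `x - [0,t]ν` stays in `Q`. -/
noncomputable def dMinus [NormedAddCommGroup E] [NormedSpace ℝ E]
    (Q : Set E) (x ν : E) : ℝ :=
  sSup {t : ℝ | 0 < t ∧ ∀ s : ℝ, 0 ≤ s → s ≤ t → x - s • ν ∈ Q}

/-- `gapWidth Q x = d(x)`: infimum over unit directions `ν` of `d_ν⁺(x) + d_ν⁻(x)`. -/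
noncomputable def gapWidth [NormedAddCommGroup E] [NormedSpace ℝ E]
    (Q : Set E) (x : E) : ℝ :=
  sInf {d : ℝ | ∃ ν : E, ‖ν‖ = 1 ∧ d = dPlus Q x ν + dMinus Q x ν}

theorem sum_mul_norm_le_sqrt [NormedAddCommGroup E] {ι : Type*} [Fintype ι] {w : ι → ℝ}
    (hw₀ : ∀ i, 0 ≤ w i) (hw₁ : ∑ i, w i = 1) (z : ι → E) :
    ∑ i, w i * ‖z i‖ ≤ √(∑ i, w i * ‖z i‖ ^ 2) :=
  Real.le_sqrt_of_sq_le <| Real.pow_arith_mean_le_arith_mean_pow _ w (fun i => ‖z i‖)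
    (fun i _ => hw₀ i) hw₁ (fun _ _ => norm_nonneg _) 2

section Envelope

variable [NormedAddCommGroup E] [NormedSpace ℝ E]

theorem affine_le_convEnv {g : E → ℝ} (l : E →ᵃ[ℝ] ℝ) (hl : ∀ y, l y ≤ g y) (x : E) :
    l x ≤ convEnv g x :=
  le_csSup ⟨g x, by rintro _ ⟨l', hl', rfl⟩; exact hl' x⟩ ⟨l, hl, rfl⟩

theorem convEnv_le {g : E → ℝ} (l₀ : E →ᵃ[ℝ] ℝ) (hl₀ : ∀ y, l₀ y ≤ g y) {x : E} {c : ℝ}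
    (h : ∀ l : E →ᵃ[ℝ] ℝ, (∀ y, l y ≤ g y) → l x ≤ c) : convEnv g x ≤ c := by
  refine csSup_le ⟨_, l₀, hl₀, rfl⟩ ?_
  rintro _ ⟨l, hl, rfl⟩
  exact h l hl

theorem affine_sum {ι : Type*} [Fintype ι] (l : E →ᵃ[ℝ] ℝ) {w : ι → ℝ} (hw₁ : ∑ i, w i = 1)
    (y : ι → E) : l (∑ i, w i • y i) = ∑ i, w i * l (y i) := by
  have hl : ∀ z, l z = l.linear z + l 0 := fun z => congrFun l.decomp z
  have hs : ∑ i, w i * l (y i) = ∑ i, (w i * l.linear (y i) + w i * l 0) :=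
    Finset.sum_congr rfl fun i _ => by rw [hl, mul_add]
  rw [hl, hs, Finset.sum_add_distrib, ← Finset.sum_mul, hw₁, one_mul, map_sum]
  simp

theorem convEnv_le_sum {g : E → ℝ} (l₀ : E →ᵃ[ℝ] ℝ) (hl₀ : ∀ y, l₀ y ≤ g y)
    {ι : Type*} [Fintype ι] {w : ι → ℝ} (hw₀ : ∀ i, 0 ≤ w i) (hw₁ : ∑ i, w i = 1) (y : ι → E) :
    convEnv g (∑ i, w i • y i) ≤ ∑ i, w i * g (y i) := by
  refine convEnv_le l₀ hl₀ fun l hl => ?_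
  rw [affine_sum l hw₁]
  exact Finset.sum_le_sum fun i _ => mul_le_mul_of_nonneg_left (hl _) (hw₀ i)

/-- The convex envelope is approximated by convex combinations of values of the function. -/
theorem exists_sum_lt_convEnv_add [FiniteDimensional ℝ E] {g : E → ℝ} (l₀ : E →ᵃ[ℝ] ℝ)
    (hl₀ : ∀ y, l₀ y ≤ g y) (x : E) {ε : ℝ} (hε : 0 < ε) :
    ∃ (ι : Type) (_ : Fintype ι) (w : ι → ℝ) (y : ι → E), (∀ i, 0 ≤ w i) ∧ ∑ i, w i = 1 ∧
      ∑ i, w i • y i = x ∧ ∑ i, w i * g (y i) < convEnv g x + ε := by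
  set S : Set (E × ℝ) := convexHull ℝ (range fun z => (z, g z)) with hS
  have hSconv : Convex ℝ S := convex_convexHull ℝ _
  have hmem : ∀ z, (z, g z) ∈ S := fun z => subset_convexHull ℝ _ ⟨z, rfl⟩
  have hbelow : ∀ p ∈ S, l₀ p.1 ≤ p.2 := by
    have hc : Convex ℝ {p : E × ℝ | l₀ p.1 ≤ p.2} := by
      intro p hp q hq a b ha hb hab
      simp only [mem_ofPred_eq, Prod.fst_add, Prod.snd_add, Prod.smul_fst, Prod.smul_snd,
        Convex.combo_affine_apply hab, smul_eq_mul] at *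
      gcongr
    exact convexHull_min (by rintro _ ⟨z, rfl⟩; exact hl₀ z) hc
  set C : E → ℝ := fun z => sInf {v | (z, v) ∈ S} with hC
  have hbdd : ∀ z, BddBelow {v | (z, v) ∈ S} := fun z => ⟨l₀ z, fun v hv => hbelow _ hv⟩
  have hne : ∀ z, {v | (z, v) ∈ S}.Nonempty := fun z => ⟨_, hmem z⟩
  have hCconv : ConvexOn ℝ univ C := by
    refine ⟨convex_univ, fun p _ q _ a b ha hb hab => le_of_forall_pos_le_add fun δ hδ => ?_⟩
    obtain ⟨u, hu, hu'⟩ := exists_lt_of_csInf_lt (hne p) (lt_add_of_pos_right (C p) hδ)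
    obtain ⟨v, hv, hv'⟩ := exists_lt_of_csInf_lt (hne q) (lt_add_of_pos_right (C q) hδ)
    have huv : (a • p + b • q, a • u + b • v) ∈ S := hSconv hu hv ha hb hab
    have h1 : a * u ≤ a * (C p + δ) := mul_le_mul_of_nonneg_left hu'.le ha
    have h2 : b * v ≤ b * (C q + δ) := mul_le_mul_of_nonneg_left hv'.le hb
    have h3 : C (a • p + b • q) ≤ a • u + b • v := csInf_le (hbdd _) huv
    have h4 : a * δ + b * δ = δ := by rw [← add_mul, hab, one_mul]
    simp only [smul_eq_mul] at *
    linarith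
  have hCenv : C x ≤ convEnv g x := by
    refine le_of_forall_lt fun r hr => ?_
    obtain ⟨r', hrr', hr'⟩ := exists_between hr
    obtain ⟨l, c, hlc, hlx⟩ := ConvexOn.exists_affine_le_of_lt (𝕜 := ℝ) (mem_univ x) hr'
      isClosed_univ (hCconv.locallyLipschitz.continuous.lowerSemicontinuous.lowerSemicontinuousOn _)
      hCconv
    have hle := affine_le_convEnv (g := g)
      ((l : E →ₗ[ℝ] ℝ).toAffineMap + AffineMap.const ℝ E c) (fun y => by
        have h1 := hlc ⟨y, mem_univ y⟩
        have h2 : C y ≤ g y := csInf_le (hbdd _) (hmem y)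
        simp at h1 ⊢
        linarith) x
    simp at hle hlx
    linarith
  obtain ⟨v, hv, hv'⟩ := exists_lt_of_csInf_lt (hne x)
    (lt_of_le_of_lt hCenv (lt_add_of_pos_right _ hε))
  obtain ⟨ι, hι, w, z, hw₀, hw₁, hz, hsum⟩ := mem_convexHull_iff_exists_fintype.1 hv
  choose y hy using hz
  have h1 := congrArg Prod.fst hsum
  have h2 := congrArg Prod.snd hsum
  simp only [← hy, Prod.fst_sum, Prod.snd_sum, Prod.smul_fst, Prod.smul_snd, smul_eq_mul]
    at h1 h2
  exact ⟨ι, hι, w, y, hw₀, hw₁, h1, h2 ▸ hv'⟩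

end Envelope

section Comparison

variable [NormedAddCommGroup E] [InnerProductSpace ℝ E]

theorem sum_mul_norm_sq {ι : Type*} [Fintype ι] {w : ι → ℝ} (hw₁ : ∑ i, w i = 1) {y : ι → E}
    {x : E} (hx : ∑ i, w i • y i = x) :
    ∑ i, w i * ‖y i‖ ^ 2 = ‖x‖ ^ 2 + ∑ i, w i * ‖y i - x‖ ^ 2 := by
  have h1 : ∀ i, w i * ‖y i - x‖ ^ 2
      = w i * ‖y i‖ ^ 2 - 2 * inner ℝ (w i • y i) x + w i * ‖x‖ ^ 2 := fun i => by
    rw [norm_sub_sq_real, real_inner_smul_left]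
    ring
  simp_rw [h1, Finset.sum_add_distrib, Finset.sum_sub_distrib, ← Finset.mul_sum, ← sum_inner,
    ← Finset.sum_mul, hw₁, hx, real_inner_self_eq_norm_sq]
  ring

/-- An affine function is controlled at an interior point of a segment by its values at the
endpoints, relative to a multiple of the squared norm. -/
theorem affine_le_of_le_endpoints (l : E →ᵃ[ℝ] ℝ) {x ν : E} (hν : ‖ν‖ = 1) {lam t₁ t₂ c₁ c₂ : ℝ}
    (ht₁ : 0 < t₁) (ht₂ : 0 < t₂) (h₁ : l (x + t₁ • ν) ≤ lam * ‖x + t₁ • ν‖ ^ 2 + c₁)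
    (h₂ : l (x - t₂ • ν) ≤ lam * ‖x - t₂ • ν‖ ^ 2 + c₂) :
    l x ≤ lam * ‖x‖ ^ 2 + lam * (t₁ * t₂) + (t₂ * c₁ + t₁ * c₂) / (t₁ + t₂) := by
  have hl : ∀ z, l z = l.linear z + l 0 := fun z => congrFun l.decomp z
  have hpos : 0 < t₁ + t₂ := add_pos ht₁ ht₂
  rw [hl, map_add, map_smul, norm_add_sq_real, norm_smul, hν, real_inner_smul_right] at h₁
  rw [hl, map_sub, map_smul, norm_sub_sq_real, norm_smul, hν, real_inner_smul_right] at h₂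
  simp only [Real.norm_eq_abs, mul_one, sq_abs, smul_eq_mul] at h₁ h₂
  rw [hl, ← sub_le_iff_le_add', le_div_iff₀ hpos]
  nlinarith [mul_le_mul_of_nonneg_left h₁ ht₂.le, mul_le_mul_of_nonneg_left h₂ ht₁.le]

/-- Comparison of convex envelopes along a chord: if `F` dominates the Lipschitz function `φ`, with
equality at the two ends of a chord through `x`, and the gap between `lam * ‖·‖ ^ 2 + F` and `H` is
at least `2 * φ`, then the gap of the envelopes at `x` is almost `2 * φ x`. -/
theorem convEnv_add_le_convEnv [FiniteDimensional ℝ E] {F φ H : E → ℝ} {lam L t₁ t₂ : ℝ} {x ν : E}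
    (hlam : 0 < lam) (hL : 0 < L) (hφ : ∀ y z, |φ y - φ z| ≤ L * dist y z) (hφF : ∀ y, φ y ≤ F y)
    (hν : ‖ν‖ = 1) (ht₁ : 0 < t₁) (ht₂ : 0 < t₂) (hF₁ : F (x + t₁ • ν) = φ (x + t₁ • ν))
    (hF₂ : F (x - t₂ • ν) = φ (x - t₂ • ν)) (l₀ : E →ᵃ[ℝ] ℝ) (hl₀ : ∀ y, l₀ y ≤ H y)
    (l₁ : E →ᵃ[ℝ] ℝ) (hl₁ : ∀ y, l₁ y ≤ lam * ‖y‖ ^ 2 + F y)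
    (hH : ∀ y, H y + 2 * φ y ≤ lam * ‖y‖ ^ 2 + F y) :
    convEnv H x + 2 * φ x - 2 * (L * ((t₁ + t₂) / 2 + L / lam))
      ≤ convEnv (fun y => lam * ‖y‖ ^ 2 + F y) x := by
  set P := convEnv (fun y => lam * ‖y‖ ^ 2 + F y) x with hP
  obtain ⟨s, hs, hst⟩ : ∃ s, 0 < s ∧ s ^ 2 = t₁ * t₂ :=
    ⟨√(t₁ * t₂), by positivity, Real.sq_sqrt (by positivity)⟩
  have hs2 : 2 * s ≤ t₁ + t₂ := by
    refine abs_le_of_sq_le_sq' ?_ (by positivity) |>.2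
    nlinarith [sq_nonneg (t₁ - t₂)]
  have hφ₁ : φ (x + t₁ • ν) ≤ φ x + L * t₁ := by
    have h := (le_abs_self _).trans (hφ (x + t₁ • ν) x)
    rw [dist_eq_norm, add_sub_cancel_left, norm_smul, hν, mul_one, Real.norm_of_nonneg ht₁.le] at h
    linarith
  have hφ₂ : φ (x - t₂ • ν) ≤ φ x + L * t₂ := by
    have h := (le_abs_self _).trans (hφ (x - t₂ • ν) x)
    rw [dist_eq_norm, sub_sub_cancel_left, norm_neg, norm_smul, hν, mul_one,
      Real.norm_of_nonneg ht₂.le] at h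
    linarith
  have hPs : P ≤ lam * ‖x‖ ^ 2 + lam * s ^ 2 + φ x + L * s := by
    refine convEnv_le l₁ hl₁ fun l hl => ?_
    have h := affine_le_of_le_endpoints l hν ht₁ ht₂
      ((hl _).trans (add_le_add_right (hF₁.trans_le hφ₁) _))
      ((hl _).trans (add_le_add_right (hF₂.trans_le hφ₂) _))
    have hmean : (t₂ * (φ x + L * t₁) + t₁ * (φ x + L * t₂)) / (t₁ + t₂) ≤ φ x + L * s := by
      rw [div_le_iff₀ (by positivity)]
      have : L * s * (2 * s) ≤ L * s * (t₁ + t₂) := by gcongr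
      linear_combination this - 2 * L * hst
    rw [hst]
    linarith
  refine le_of_forall_pos_le_add fun η hη => ?_
  set k := 1 + 2 * L / (lam * s) with hk
  have hk0 : 0 < k := by positivity
  obtain ⟨ι, _, w, y, hw₀, hw₁, hx, hsum⟩ := exists_sum_lt_convEnv_add l₁ hl₁ x (div_pos hη hk0)
  rw [← hP] at hsum
  set ε := η / k with hε
  have hεk : ε + 2 * L * (ε / (lam * s)) = η := by
    have : ε * k = η := div_mul_cancel₀ _ hk0.ne'
    rw [← this, hk]
    ring
  have hεpos : 0 < ε := by positivity
  set σ := √(∑ i, w i * ‖y i - x‖ ^ 2) with hσ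
  have hσ0 : 0 ≤ σ := Real.sqrt_nonneg _
  have hσ2 : σ ^ 2 = ∑ i, w i * ‖y i - x‖ ^ 2 :=
    Real.sq_sqrt (Finset.sum_nonneg fun i _ => mul_nonneg (hw₀ i) (sq_nonneg _))
  have hmean : φ x - L * σ ≤ ∑ i, w i * φ (y i) := by
    have h1 : ∑ i, w i * (φ x - L * ‖y i - x‖) ≤ ∑ i, w i * φ (y i) := by
      refine Finset.sum_le_sum fun i _ => mul_le_mul_of_nonneg_left ?_ (hw₀ i)
      have := neg_le_of_abs_le (hφ (y i) x)
      rw [dist_eq_norm] at this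
      linarith
    have h2 : ∑ i, w i * (φ x - L * ‖y i - x‖) = φ x - L * ∑ i, w i * ‖y i - x‖ := by
      simp_rw [mul_sub, Finset.sum_sub_distrib, ← Finset.sum_mul, hw₁, one_mul, mul_left_comm _ L,
        ← Finset.mul_sum]
    have h3 := mul_le_mul_of_nonneg_left (sum_mul_norm_le_sqrt hw₀ hw₁ fun i => y i - x) hL.le
    linarith
  have hsq : ∑ i, w i * (lam * ‖y i‖ ^ 2) = lam * ‖x‖ ^ 2 + lam * σ ^ 2 := by
    simp_rw [mul_left_comm _ lam, ← Finset.mul_sum, sum_mul_norm_sq hw₁ hx, hσ2]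
    ring
  have hspread : lam * σ ^ 2 - L * σ ≤ lam * s ^ 2 + L * s + ε := by
    have : ∑ i, w i * (lam * ‖y i‖ ^ 2) + ∑ i, w i * φ (y i)
        ≤ ∑ i, w i * (lam * ‖y i‖ ^ 2 + F (y i)) := by
      rw [← Finset.sum_add_distrib]
      refine Finset.sum_le_sum fun i _ => ?_
      rw [← mul_add]
      exact mul_le_mul_of_nonneg_left (add_le_add_right (hφF _) _) (hw₀ i)
    linarith
  have hσs : σ ≤ s + L / lam + ε / (lam * s) := by
    by_contra! h
    have h1 : L + ε / s < lam * (σ - s) := by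
      have : lam * (L / lam + ε / (lam * s)) < lam * (σ - s) := by gcongr; linarith
      convert this using 1
      field_simp
    have h2 : ε ≤ ε / s * (σ + s) := by
      rw [div_mul_eq_mul_div, le_div_iff₀ hs]
      nlinarith
    nlinarith [mul_lt_mul_of_pos_right h1 (by linarith : 0 < σ + s)]
  have hHle : convEnv H x + 2 * ∑ i, w i * φ (y i) ≤ P + ε := by
    have h1 := convEnv_le_sum l₀ hl₀ hw₀ hw₁ y
    rw [hx] at h1
    have h2 : ∑ i, w i * H (y i) + 2 * ∑ i, w i * φ (y i)
        ≤ ∑ i, w i * (lam * ‖y i‖ ^ 2 + F (y i)) := by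
      rw [Finset.mul_sum, ← Finset.sum_add_distrib]
      refine Finset.sum_le_sum fun i _ => ?_
      have := mul_le_mul_of_nonneg_left (hH (y i)) (hw₀ i)
      linarith
    linarith
  have hLσ : L * σ ≤ L * ((t₁ + t₂) / 2 + L / lam + ε / (lam * s)) := by gcongr; linarith
  linarith

end Comparison

section Chord

variable [NormedAddCommGroup E] [NormedSpace ℝ E]

theorem exists_forall_mem_le_of_isBounded {O : Set E} (hO : Bornology.IsBounded O) (x : E) {ν : E}
    (hν : ‖ν‖ = 1) : ∃ r : ℝ, ∀ t, 0 ≤ t → x + t • ν ∈ O → t ≤ r := by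
  obtain ⟨r, hr⟩ := hO.subset_closedBall x
  refine ⟨r, fun t ht h => ?_⟩
  simpa [dist_eq_norm, norm_smul, hν, abs_of_nonneg ht] using hr h

theorem exists_exit_frontier {O : Set E} (hO : IsOpen O) (hOb : Bornology.IsBounded O) {x ν : E}
    (hx : x ∈ O) (hν : ‖ν‖ = 1) :
    ∃ t : ℝ, 0 < t ∧ x + t • ν ∈ frontier O ∧ ∀ s, 0 ≤ s → s < t → x + s • ν ∈ O := by
  obtain ⟨r, hr⟩ := exists_forall_mem_le_of_isBounded hOb x hν
  have hcont : Continuous fun t : ℝ => x + t • ν := by fun_prop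
  set T : Set ℝ := Ici 0 ∩ (fun t : ℝ => x + t • ν) ⁻¹' Oᶜ with hT
  have hTc : IsClosed T := isClosed_Ici.inter (hO.isClosed_compl.preimage hcont)
  have hTne : T.Nonempty := ⟨max r 0 + 1, by simp only [mem_Ici]; positivity, fun h => by
    linarith [hr _ (by positivity) h, le_max_left r 0]⟩
  have hTb : BddBelow T := ⟨0, fun t ht => ht.1⟩
  have hmem := hTc.csInf_mem hTne hTb
  set t := sInf T
  have hlt : ∀ s, 0 ≤ s → s < t → x + s • ν ∈ O := fun s hs hst => by
    by_contra h
    exact hst.not_ge (csInf_le hTb ⟨hs, h⟩)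
  have ht : 0 < t := lt_of_le_of_ne hmem.1 fun h => hmem.2 (by simpa [← h] using hx)
  refine ⟨t, ht, ?_, hlt⟩
  rw [hO.frontier_eq]
  refine ⟨?_, hmem.2⟩
  have h1 : t ∈ closure (Ico 0 t) := by
    rw [closure_Ico ht.ne]
    exact ⟨ht.le, le_rfl⟩
  exact map_mem_closure (f := fun s : ℝ => x + s • ν) hcont h1 fun s hs => hlt s hs.1 hs.2

theorem le_dPlus {O : Set E} (hO : Bornology.IsBounded O) {x ν : E} (hν : ‖ν‖ = 1) {t : ℝ}
    (ht : 0 < t) (h : ∀ s, 0 ≤ s → s < t → x + s • ν ∈ O) : t ≤ dPlus O x ν := by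
  obtain ⟨r, hr⟩ := exists_forall_mem_le_of_isBounded hO x hν
  refine le_of_forall_lt fun u hu => ?_
  obtain ⟨v, huv, hv⟩ := exists_between (max_lt hu ht)
  have hv0 : 0 < v := (le_max_right _ _).trans_lt huv
  refine ((le_max_left _ _).trans_lt huv).trans_le (le_csSup ⟨r, ?_⟩ ⟨hv0, fun s hs hsv =>
    h s hs (hsv.trans_lt hv)⟩)
  rintro t' ⟨ht', h'⟩
  exact hr t' ht'.le (h' t' ht'.le le_rfl)

theorem dMinus_eq_dPlus_neg (O : Set E) (x ν : E) : dMinus O x ν = dPlus O x (-ν) := by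
  simp [dMinus, dPlus, sub_eq_add_neg]

end Chord

section LevelSet

variable [NormedAddCommGroup E] [InnerProductSpace ℝ E] {f : E → ℝ} {K : Set E}
  {c lam A R M : ℝ}

theorem affine_le_of_le_on_level (hf : Continuous f) (hR : {y | f y ≤ c} ⊆ ball 0 R)
    (hlam : 0 < lam) (hM : A + lam * (2 * R + 1) ^ 2 < M) {ν : E} (hν : ‖ν‖ = 1) {l : E →ᵃ[ℝ] ℝ}
    (hl : ∀ z, f z = c → l z ≤ lam * ‖z‖ ^ 2 + A) {y : E} (hy : f y < c) :
    l y ≤ lam * ‖y‖ ^ 2 + M := by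
  have hO : IsOpen {z | f z < c} := isOpen_lt hf continuous_const
  have hOb : Bornology.IsBounded {z | f z < c} :=
    isBounded_ball.subset (Subset.trans (fun z (hz : f z < c) => hz.le) hR)
  obtain ⟨t₁, ht₁, hf₁, -⟩ := exists_exit_frontier hO hOb hy hν
  obtain ⟨t₂, ht₂, hf₂, -⟩ := exists_exit_frontier hO hOb hy (by rwa [norm_neg] : ‖-ν‖ = 1)
  replace hf₁ : f _ = c := frontier_lt_subset_eq hf continuous_const hf₁
  replace hf₂ : f _ = c := frontier_lt_subset_eq hf continuous_const hf₂
  have hbound : ∀ (μ : E) (t : ℝ), ‖μ‖ = 1 → 0 < t → f (y + t • μ) = c → t ≤ 2 * R := by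
    intro μ t hμ ht h
    have h1 : y ∈ ball 0 R := hR hy.le
    have h2 : y + t • μ ∈ ball 0 R := hR h.le
    rw [mem_ball_zero_iff] at h1 h2
    have h3 := norm_sub_le (y + t • μ) y
    rw [add_sub_cancel_left, norm_smul, hμ, Real.norm_of_nonneg ht.le] at h3
    linarith
  have hb₁ := hbound ν t₁ hν ht₁ hf₁
  have hb₂ := hbound (-ν) t₂ (by rwa [norm_neg]) ht₂ hf₂
  rw [smul_neg, ← sub_eq_add_neg] at hf₂
  have h := affine_le_of_le_endpoints l hν ht₁ ht₂ (hl _ hf₁) (hl _ hf₂)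
  have hmean : (t₂ * A + t₁ * A) / (t₁ + t₂) = A := by
    field_simp
    ring
  have ht : lam * (t₁ * t₂) ≤ lam * (2 * R + 1) ^ 2 := by
    gcongr
    nlinarith
  linarith

theorem affine_le_outside_level (hf : Continuous f) {l : E →ᵃ[ℝ] ℝ}
    (hl : ∀ z, f z = c → l z ≤ lam * ‖z‖ ^ 2 - c) {x y : E} (hx : f x < c)
    (hlx : lam * ‖x‖ ^ 2 - c ≤ l x) (hlam : 0 ≤ lam) (hy : c < f y) :
    l y ≤ lam * ‖y‖ ^ 2 - c := by
  have hcont : ContinuousOn (fun θ : ℝ => f (AffineMap.lineMap x y θ)) (Icc 0 1) :=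
    (hf.comp AffineMap.lineMap_continuous).continuousOn
  obtain ⟨θ, hθ, hθc⟩ := intermediate_value_Icc zero_le_one hcont
    (show c ∈ Icc _ _ by simpa using ⟨hx.le, hy.le⟩)
  have hθ0 : 0 < θ := lt_of_le_of_ne hθ.1 (by rintro rfl; simp at hθc; linarith)
  have h := hl _ hθc
  rw [AffineMap.apply_lineMap, AffineMap.lineMap_apply_module, AffineMap.lineMap_apply_module,
    norm_add_sq_real, norm_smul, norm_smul, real_inner_smul_left, real_inner_smul_right,
    Real.norm_of_nonneg hθ0.le, Real.norm_of_nonneg (by linarith [hθ.2] : 0 ≤ 1 - θ)] at h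
  have h1 : 2 * inner ℝ x y ≤ ‖x‖ ^ 2 + ‖y‖ ^ 2 := by
    nlinarith [real_inner_le_norm x y, sq_nonneg (‖x‖ - ‖y‖)]
  have h2 : 0 ≤ lam * (θ * (1 - θ)) :=
    mul_nonneg hlam (mul_nonneg hθ0.le (by linarith [hθ.2]))
  have h3 := mul_le_mul_of_nonneg_left h1 h2
  have h4 := mul_le_mul_of_nonneg_left hlx (by linarith [hθ.2] : 0 ≤ 1 - θ)
  simp only [smul_eq_mul] at h
  refine le_of_mul_le_mul_left ?_ hθ0
  linarith

/-- Error estimate for the average approximation at a point of a chord with ends in the sample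
set. -/
theorem abs_avgApprox_sub_le [FiniteDimensional ℝ E] (hf : Continuous f)
    (hcK : ∀ y, f y = c → y ∈ K) (hKc : ∀ y ∈ K, f y ≤ c) (hR : {y | f y ≤ c} ⊆ ball 0 R)
    {φ : E → ℝ} {L : ℝ} (hL : 0 < L) (hφ : ∀ y z, |φ y - φ z| ≤ L * dist y z)
    (hφA : ∀ y, |φ y| ≤ A) (hcA : |c| ≤ A) (hφf : ∀ y, f y ≤ c → φ y = f y) (hφc : ∀ y, φ y ≤ c)
    (hlam : 0 < lam) (hM : A + lam * (2 * R + 1) ^ 2 < M) {x ν : E} (hx : f x < c) (hν : ‖ν‖ = 1)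
    {t₁ t₂ : ℝ} (ht₁ : 0 < t₁) (ht₂ : 0 < t₂) (hK₁ : x + t₁ • ν ∈ K) (hK₂ : x - t₂ • ν ∈ K) :
    |avgApprox lam M f K x - f x| ≤ L * ((t₁ + t₂) / 2 + L / lam) := by
  have hAM : A < M := by nlinarith [mul_nonneg hlam.le (sq_nonneg (2 * R + 1))]
  have hA : 0 ≤ A := (abs_nonneg _).trans hcA
  obtain ⟨hc₁, hc₂⟩ := abs_le.1 hcA
  have hφ₁ : ∀ y, -A ≤ φ y := fun y => (abs_le.1 (hφA y)).1
  have hφ₂ : ∀ y, φ y ≤ A := fun y => (abs_le.1 (hφA y)).2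
  have hφK : ∀ y ∈ K, φ y = f y := fun y hy => hφf y (hKc y hy)
  have hsq : ∀ y : E, 0 ≤ lam * ‖y‖ ^ 2 := fun y => by positivity
  have hin : ∀ l : E →ᵃ[ℝ] ℝ, (∀ z ∈ K, l z ≤ lam * ‖z‖ ^ 2 + A) → ∀ y, f y < c →
      l y ≤ lam * ‖y‖ ^ 2 + M := fun l hl y hy =>
    affine_le_of_le_on_level hf hR hlam hM hν (fun z hz => hl z (hcK z hz)) hy
  have hout : ∀ l : E →ᵃ[ℝ] ℝ, (∀ z ∈ K, l z ≤ lam * ‖z‖ ^ 2 - f z) →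
      lam * ‖x‖ ^ 2 - c ≤ l x → ∀ y, c < f y → l y ≤ lam * ‖y‖ ^ 2 - c := fun l hl hlx y hy =>
    affine_le_outside_level hf (fun z hz => hz ▸ hl z (hcK z hz)) hx hlx hlam.le hy
  have hne : ∀ y, y ∉ K → f y ≤ c → f y < c := fun y hy h => lt_of_le_of_ne h fun h' =>
    hy (hcK y h')
  obtain ⟨q₀, hq₀⟩ : ∃ q : E →ᵃ[ℝ] ℝ, ∀ y, q y = lam * ‖y‖ ^ 2 - lam * ‖y - x‖ ^ 2 - c := by
    refine ⟨(((2 * lam) • innerSL ℝ x : E →L[ℝ] ℝ) : E →ₗ[ℝ] ℝ).toAffineMap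
      + AffineMap.const ℝ E (-(lam * ‖x‖ ^ 2) - c), fun y => ?_⟩
    simp [norm_sub_sq_real, real_inner_comm]
    ring
  have hq₀x : q₀ x = lam * ‖x‖ ^ 2 - c := by simp [hq₀]
  set g : E → ℝ := fun y => lam * ‖y‖ ^ 2 - extendBy f K (-M) y with hg
  have hgK : ∀ y ∈ K, g y = lam * ‖y‖ ^ 2 - f y := fun y hy => by simp [hg, extendBy, hy]
  have hgKc : ∀ y ∉ K, g y = lam * ‖y‖ ^ 2 + M := fun y hy => by simp [hg, extendBy, hy]
  set h : E → ℝ := fun y => lam * ‖y‖ ^ 2 + extendBy f K M y with hh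
  have hhK : ∀ y ∈ K, h y = lam * ‖y‖ ^ 2 + f y := fun y hy => by simp [hh, extendBy, hy]
  have hhKc : ∀ y ∉ K, h y = lam * ‖y‖ ^ 2 + M := fun y hy => by simp [hh, extendBy, hy]
  have hq₀g : ∀ y, q₀ y ≤ g y := fun y => by
    have := hsq (y - x)
    rw [hq₀]
    by_cases hy : y ∈ K
    · linarith [hgK y hy, hKc y hy]
    · linarith [hgKc y hy]
  have henv : ∀ l : E →ᵃ[ℝ] ℝ, (∀ y ∈ K, l y ≤ lam * ‖y‖ ^ 2 - f y) →
      lam * ‖x‖ ^ 2 - c ≤ l x → ∀ y, l y ≤ g y := fun l hl hlx y => by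
    by_cases hy : y ∈ K
    · exact (hl y hy).trans (hgK y hy).ge
    rw [hgKc y hy]
    rcases le_or_gt (f y) c with hyc | hyc
    · exact hin l (fun z hz => by linarith [hl z hz, hφK z hz, hφ₁ z]) y (hne y hy hyc)
    · linarith [hout l hl hlx y hyc]
  have hconst : ∀ y, AffineMap.const ℝ E (-A) y ≤ h y := fun y => by
    have := hsq y
    rw [AffineMap.const_apply]
    by_cases hy : y ∈ K
    · linarith [hhK y hy, hφK y hy, hφ₁ y]
    · linarith [hhKc y hy]
  have hupper : convEnv h x - convEnv g x ≤ 2 * f x + 2 * (L * ((t₁ + t₂) / 2 + L / lam)) := by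
    set F : E → ℝ := fun y => -extendBy f K (-(M + 2 * A)) y with hF
    have hFK : ∀ y ∈ K, F y = -f y := fun y hy => by simp [hF, extendBy, hy]
    have hFKc : ∀ y ∉ K, F y = M + 2 * A := fun y hy => by simp [hF, extendBy, hy]
    have hq₀F : ∀ y, q₀ y ≤ lam * ‖y‖ ^ 2 + F y := fun y => by
      refine (hq₀g y).trans ?_
      by_cases hy : y ∈ K
      · linarith [hgK y hy, hFK y hy]
      · linarith [hgKc y hy, hFKc y hy]
    have hcore := convEnv_add_le_convEnv (F := F) (φ := fun y => -φ y) (H := h) (x := x) hlam hL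
      (fun y z => by rw [neg_sub_neg, abs_sub_comm]; exact hφ y z)
      (fun y => by
        by_cases hy : y ∈ K
        · linarith [hFK y hy, hφK y hy]
        · linarith [hFKc y hy, hφ₁ y])
      hν ht₁ ht₂ (by rw [hFK _ hK₁, hφK _ hK₁]) (by rw [hFK _ hK₂, hφK _ hK₂]) _ hconst q₀ hq₀F
      (fun y => by
        by_cases hy : y ∈ K
        · linarith [hFK y hy, hhK y hy, hφK y hy]
        · linarith [hFKc y hy, hhKc y hy, hφ₁ y])
    have hle : convEnv (fun y => lam * ‖y‖ ^ 2 + F y) x ≤ convEnv g x := by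
      refine convEnv_le q₀ hq₀F fun l hl => ?_
      rcases le_total (lam * ‖x‖ ^ 2 - c) (l x) with hlx | hlx
      · exact affine_le_convEnv l
          (henv l (fun y hy => by linarith [hl y, hFK y hy]) hlx) x
      · exact (hlx.trans hq₀x.ge).trans (affine_le_convEnv q₀ hq₀g x)
    linarith [hφf x hx.le]
  have hlower : 2 * f x - 2 * (L * ((t₁ + t₂) / 2 + L / lam)) ≤ convEnv h x - convEnv g x := by
    classical
    set F : E → ℝ := fun y => if y ∈ K then f y else if f y ≤ c then M + 2 * A else M with hF
    set H : E → ℝ := fun y => lam * ‖y‖ ^ 2 + if y ∈ K then -f y else if f y ≤ c then M else -c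
      with hH
    have hFH : ∀ y, H y + 2 * φ y ≤ lam * ‖y‖ ^ 2 + F y := fun y => by
      by_cases hy : y ∈ K
      · simp only [hF, hH, hy, if_true]
        linarith [hφK y hy]
      · by_cases hyc : f y ≤ c
        · simp only [hF, hH, hy, hyc, if_true, if_false]
          linarith [hφ₂ y]
        · simp only [hF, hH, hy, hyc, if_false]
          linarith [hφc y]
    have hFh : ∀ y, h y ≤ lam * ‖y‖ ^ 2 + F y := fun y => by
      by_cases hy : y ∈ K
      · simp only [hF, hy, if_true]
        linarith [hhK y hy]
      · rw [hhKc y hy]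
        by_cases hyc : f y ≤ c <;> simp [hF, hy, hyc, hA]
    have hq₀H : ∀ y, q₀ y ≤ H y := fun y => by
      have := hsq (y - x)
      rw [hq₀]
      by_cases hy : y ∈ K
      · simp only [hH, hy, if_true]
        linarith [hKc y hy]
      · by_cases hyc : f y ≤ c
        · simp only [hH, hy, hyc, if_true, if_false]
          linarith
        · simp only [hH, hy, hyc, if_false]
          linarith
    have hcore := convEnv_add_le_convEnv (F := F) (φ := φ) (H := H) (x := x) hlam hL hφ
      (fun y => by
        by_cases hy : y ∈ K
        · simp [hF, hy, hφK y hy]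
        · by_cases hyc : f y ≤ c
          · simp only [hF, hy, hyc, if_true, if_false]
            linarith [hφ₂ y]
          · simp only [hF, hy, hyc, if_false]
            linarith [hφ₂ y])
      hν ht₁ ht₂ (by simp [hF, hK₁, hφK _ hK₁]) (by simp [hF, hK₂, hφK _ hK₂]) q₀ hq₀H
      _ (fun y => (hconst y).trans (hFh y)) hFH
    have hle : convEnv (fun y => lam * ‖y‖ ^ 2 + F y) x ≤ convEnv h x := by
      refine convEnv_le _ (fun y => (hconst y).trans (hFh y)) fun l hl =>
        affine_le_convEnv l (fun y => ?_) x
      have hlK : ∀ z ∈ K, l z ≤ lam * ‖z‖ ^ 2 + f z := fun z hz => by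
        simpa [hF, hz] using hl z
      by_cases hy : y ∈ K
      · exact (hlK y hy).trans (hhK y hy).ge
      rw [hhKc y hy]
      by_cases hyc : f y ≤ c
      · exact hin l (fun z hz => by linarith [hlK z hz, hφK z hz, hφ₂ z]) y (hne y hy hyc)
      · simpa [hF, hy, hyc] using hl y
    have hge : convEnv g x ≤ convEnv H x := by
      refine convEnv_le q₀ hq₀g fun l hl => ?_
      have hlK : ∀ z ∈ K, l z ≤ lam * ‖z‖ ^ 2 - f z := fun z hz => (hl z).trans (hgK z hz).le
      rcases le_total (lam * ‖x‖ ^ 2 - c) (l x) with hlx | hlx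
      · refine affine_le_convEnv l (fun y => ?_) x
        by_cases hy : y ∈ K
        · simpa [hH, hy, ← sub_eq_add_neg] using hlK y hy
        by_cases hyc : f y ≤ c
        · simpa [hH, hy, hyc, hgKc y hy] using hl y
        · simpa [hH, hy, hyc, ← sub_eq_add_neg] using hout l hlK hlx y (not_le.1 hyc)
      · exact (hlx.trans hq₀x.ge).trans (affine_le_convEnv q₀ hq₀H x)
    linarith [hφf x hx.le]
  have havg : avgApprox lam M f K x = (convEnv h x - convEnv g x) / 2 := by
    simp only [avgApprox, lowerTransform, upperTransform, hg, hh]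
    ring
  rw [havg, abs_le]
  constructor <;> linarith

end LevelSet

/-- **Error estimate for level-set approximation (Lipschitz case).** -/
theorem level_set_error_estimate_lipschitz {n : ℕ} (f : EuclideanSpace ℝ (Fin n) → ℝ)
    (hf : Continuous f) (m : ℕ) (hm : 1 ≤ m) (a : Fin (m + 1) → ℝ) (ha : StrictMono a)
    (hVne : ∀ i : Fin (m + 1), {x : EuclideanSpace ℝ (Fin n) | f x ≤ a i}.Nonempty)
    (hVcpt : ∀ i : Fin (m + 1), IsCompact {x : EuclideanSpace ℝ (Fin n) | f x ≤ a i})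
    (K : Set (EuclideanSpace ℝ (Fin n)))
    (hK : K = ⋃ i : Fin (m + 1), {x : EuclideanSpace ℝ (Fin n) | f x = a i})
    (R : ℝ) (hR : 0 < R)
    (hVR : {x : EuclideanSpace ℝ (Fin n) | f x ≤ a (Fin.last m)} ⊆ Metric.ball 0 R)
    (ftil : EuclideanSpace ℝ (Fin n) → ℝ)
    (Ltil : ℝ) (hLtil : 0 < Ltil)
    (hlip : ∀ x y : EuclideanSpace ℝ (Fin n), |ftil x - ftil y| ≤ Ltil * dist x y)
    (A0til : ℝ) (hA0til : ∀ x, |ftil x| ≤ A0til)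
    (hfeq : ∀ x : EuclideanSpace ℝ (Fin n), f x ≤ a (Fin.last m) → ftil x = f x)
    (hfout : ∀ x : EuclideanSpace ℝ (Fin n), R ≤ ‖x‖ → ftil x = a (Fin.last m) + 1)
    (lam M : ℝ) (hlam : a (Fin.last m) - a 0 + 1 < lam)
    (hM : A0til + lam * (2 * R + 1) ^ 2 < M) :
    ∀ i : Fin m, ∀ x ∈ {y : EuclideanSpace ℝ (Fin n) | a i.castSucc < f y ∧ f y < a i.succ},
      |avgApprox lam M f K x - f x| ≤
        Ltil * gapWidth {y : EuclideanSpace ℝ (Fin n) | a i.castSucc < f y ∧ f y < a i.succ} x +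
          Ltil ^ 2 / lam := by
  intro i x hx
  obtain ⟨hx₁, hx₂⟩ := hx
  set Ω : Set (EuclideanSpace ℝ (Fin n)) := {y | a i.castSucc < f y ∧ f y < a i.succ} with hΩ
  set c := a (Fin.last m) with hc
  have hle : ∀ j, a j ≤ c := fun j => ha.monotone (Fin.le_last j)
  have hxc : f x < c := hx₂.trans_le (hle _)
  have hlam0 : 0 < lam := by linarith [hle 0]
  obtain ⟨x₀, hx₀⟩ := hVne 0
  have hx₀x : x₀ ≠ x := by
    rintro rfl
    exact ((ha.monotone (Fin.zero_le i.castSucc)).trans_lt hx₁).not_ge hx₀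
  have : Nontrivial (EuclideanSpace ℝ (Fin n)) := ⟨x₀, x, hx₀x⟩
  obtain ⟨μ, hμ⟩ := exists_norm_eq (EuclideanSpace ℝ (Fin n)) zero_le_one
  have hcA : |c| ≤ A0til := by
    obtain ⟨t, -, ht, -⟩ := exists_exit_frontier (isOpen_lt hf continuous_const)
      ((hVcpt (Fin.last m)).isBounded.subset fun y (hy : f y < c) => hy.le) hxc hμ
    have hft : f (x + t • μ) = c := frontier_lt_subset_eq hf continuous_const ht
    rw [← hft, ← hfeq _ hft.le]
    exact hA0til _
  have hΩo : IsOpen Ω := (isOpen_lt continuous_const hf).inter (isOpen_lt hf continuous_const)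
  have hΩb : Bornology.IsBounded Ω :=
    (hVcpt (Fin.last m)).isBounded.subset fun y hy => hy.2.le.trans (hle _)
  have hΩK : frontier Ω ⊆ K := by
    intro y hy
    rw [hK, mem_iUnion]
    rcases frontier_inter_subset _ _ hy with h | h
    · exact ⟨i.castSucc, (frontier_lt_subset_eq continuous_const hf h.1).symm⟩
    · exact ⟨i.succ, frontier_lt_subset_eq hf continuous_const h.2⟩
  rw [← sub_le_iff_le_add, ← div_le_iff₀' hLtil]
  refine le_csInf ⟨_, μ, hμ, rfl⟩ ?_
  rintro _ ⟨ν, hν, rfl⟩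
  have hν' : ‖-ν‖ = 1 := by rwa [norm_neg]
  obtain ⟨t₁, ht₁, hfr₁, hlt₁⟩ := exists_exit_frontier hΩo hΩb ⟨hx₁, hx₂⟩ hν
  obtain ⟨t₂, ht₂, hfr₂, hlt₂⟩ := exists_exit_frontier hΩo hΩb ⟨hx₁, hx₂⟩ hν'
  have hd₁ := le_dPlus hΩb hν ht₁ hlt₁
  have hd₂ := le_dPlus hΩb hν' ht₂ hlt₂
  rw [smul_neg, ← sub_eq_add_neg] at hfr₂
  have h := abs_avgApprox_sub_le (K := K) (c := c) (φ := fun y => min (ftil y) c) hf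
    (fun y hy => by rw [hK, mem_iUnion]; exact ⟨_, hy⟩)
    (fun y hy => by
      rw [hK, mem_iUnion] at hy
      obtain ⟨j, hj⟩ := hy
      exact hj.trans_le (hle j))
    hVR hLtil
    (fun y z => (abs_min_sub_min_le_max _ _ _ _).trans (by simpa using hlip y z))
    (fun y => abs_min_le_max_abs_abs.trans (max_le (hA0til y) hcA)) hcA
    (fun y hy => by rw [hfeq y hy, min_eq_left hy]) (fun y => min_le_right _ _)
    hlam0 hM hxc hν ht₁ ht₂ (hΩK hfr₁) (hΩK hfr₂)
  rw [dMinus_eq_dPlus_neg, div_le_iff₀' hLtil]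
  have h1 : Ltil * ((t₁ + t₂) / 2) ≤ Ltil * (dPlus Ω x ν + dPlus Ω x (-ν)) := by
    gcongr
    linarith
  have h2 : Ltil * ((t₁ + t₂) / 2 + Ltil / lam) = Ltil * ((t₁ + t₂) / 2) + Ltil ^ 2 / lam := by
    ring
  linarith
end

section
/- Interpolation at scattered data points: Let K = {x_1, …, x_m} ⊂ ℝ^n be a finite set of distinct points and let f : K → ℝ satisfy |f(x_i) − f(x_j)| ≤ L|x_i − x_j| for all i, j and some L > 0, and −M < f(x_j) < M for all j and some M > 0. Let α = min{ |x_i − x_j| : i ≠ j } > 0. Then for every λ ≥ L/α and every x_j ∈ K, C^u_λ(f_K^{−M})(x_j) = f(x_j) and C^l_λ(f_K^{M})(x_j) = f(x_j). -/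
open Metric Set

variable {E : Type*}

/-- If `g` has an affine minorant touching it at `x`, its convex envelope agrees with `g` at `x`. -/
theorem convEnv_eq_of_affine_le [NormedAddCommGroup E] [NormedSpace ℝ E] {g : E → ℝ} {x : E}
    (l : E →ᵃ[ℝ] ℝ) (hl : ∀ y, l y ≤ g y) (hx : l x = g x) : convEnv g x = g x := by
  refine IsGreatest.csSup_eq ⟨⟨l, hl, hx.symm⟩, ?_⟩
  rintro v ⟨k, hk, rfl⟩
  exact hk x

/-- The lower transform fixes the value at `x` if a downward paraboloid with vertex
`(x, f x)` lies below `f`. -/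
theorem lowerTransform_eq_of_forall_le [NormedAddCommGroup E] [InnerProductSpace ℝ E]
    {lam : ℝ} {f : E → ℝ} {x : E} (h : ∀ y, f x ≤ f y + lam * ‖y - x‖ ^ 2) :
    lowerTransform lam f x = f x := by
  let l : E →ᵃ[ℝ] ℝ := ((2 * lam) • (innerSL ℝ x).toLinearMap).toAffineMap +
    AffineMap.const ℝ E (f x - lam * ‖x‖ ^ 2)
  have hl (y : E) : l y = 2 * lam * inner ℝ x y + (f x - lam * ‖x‖ ^ 2) := by
    simp [l]
  rw [lowerTransform, convEnv_eq_of_affine_le l]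
  · ring
  · intro y
    have hy := h y
    rw [norm_sub_sq_real, real_inner_comm] at hy
    rw [hl]
    linarith
  · rw [hl, real_inner_self_eq_norm_sq]
    ring

theorem neg_extendBy (f : E → ℝ) (K : Set E) (M : ℝ) :
    -extendBy f K (-M) = extendBy (-f) K M := by
  ext x
  by_cases hx : x ∈ K <;> simp [extendBy, hx]

/-- The lower transform of `extendBy f K M` interpolates `f` on a set `K` whose distinct points are
at distance at least `α`. -/
theorem lowerTransform_extendBy [NormedAddCommGroup E] [InnerProductSpace ℝ E] {K : Set E}
    {f : E → ℝ} {L M α lam : ℝ} (hL : 0 < L) (hlip : ∀ x ∈ K, ∀ y ∈ K, |f x - f y| ≤ L * dist x y)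
    (hM : ∀ x ∈ K, f x ≤ M) (hα : 0 < α) (hsep : ∀ x ∈ K, ∀ y ∈ K, x ≠ y → α ≤ dist x y)
    (hlam : L / α ≤ lam) {x : E} (hx : x ∈ K) :
    lowerTransform lam (extendBy f K M) x = f x := by
  have hlam0 : 0 ≤ lam := (div_pos hL hα).le.trans hlam
  have hfx : extendBy f K M x = f x := if_pos hx
  rw [← hfx]
  refine lowerTransform_eq_of_forall_le fun y => ?_
  rw [hfx, ← dist_eq_norm, dist_comm]
  by_cases hy : y ∈ K
  · rw [show extendBy f K M y = f y from if_pos hy]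
    rcases eq_or_ne x y with rfl | hxy
    · simp
    have hd := hsep x hx y hy hxy
    have hLd : L ≤ lam * dist x y :=
      ((div_le_iff₀ hα).1 hlam).trans (mul_le_mul_of_nonneg_left hd hlam0)
    have hLd' := mul_le_mul_of_nonneg_right hLd (dist_nonneg (x := x) (y := y))
    linarith [le_abs_self (f x - f y), hlip x hx y hy]
  · rw [show extendBy f K M y = M from if_neg hy]
    exact (hM x hx).trans (le_add_of_nonneg_right (by positivity))

/-- **Interpolation at scattered data points.** Let `K` be a finite set of distinct points in
`ℝ^n`, `f` Lipschitz on `K` with constant `L > 0` and `−M < f < M` on `K`.  If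
`α = min{ |x−y| : x ≠ y ∈ K }` then for every `λ ≥ L/α` and every `x ∈ K`,
`C^u_λ(f_K^{−M})(x) = f(x)` and `C^l_λ(f_K^{M})(x) = f(x)`. -/
theorem scattered_data_interpolation {n : ℕ} (K : Finset (EuclideanSpace ℝ (Fin n)))
    (hKne : K.Nonempty) (f : EuclideanSpace ℝ (Fin n) → ℝ)
    (L : ℝ) (hL : 0 < L)
    (hlip : ∀ x ∈ K, ∀ y ∈ K, |f x - f y| ≤ L * dist x y)
    (M : ℝ) (hMpos : 0 < M) (hbd : ∀ x ∈ K, -M < f x ∧ f x < M)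
    (α : ℝ)
    (hα : α = sInf {d : ℝ | ∃ x ∈ K, ∃ y ∈ K, x ≠ y ∧ d = dist x y})
    (hαpos : 0 < α)
    (lam : ℝ) (hlam : L / α ≤ lam) :
    ∀ x ∈ K,
      upperTransform lam (extendBy f (↑K) (-M)) x = f x ∧
      lowerTransform lam (extendBy f (↑K) M) x = f x := by
  have hsep : ∀ x ∈ (K : Set (EuclideanSpace ℝ (Fin n))), ∀ y ∈ (K : Set _), x ≠ y →
      α ≤ dist x y := by
    intro x hx y hy hxy
    rw [hα]
    refine csInf_le ⟨0, ?_⟩ ⟨x, hx, y, hy, hxy, rfl⟩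
    rintro d ⟨a, -, b, -, -, rfl⟩
    exact dist_nonneg
  intro x hx
  constructor
  · rw [upperTransform_eq_neg_lowerTransform, neg_extendBy,
      lowerTransform_extendBy hL ?_ ?_ hαpos hsep hlam hx, Pi.neg_apply, neg_neg]
    · intro a ha b hb
      rw [Pi.neg_apply, Pi.neg_apply, neg_sub_neg, abs_sub_comm]
      exact hlip a ha b hb
    · exact fun a ha => neg_le.1 (hbd a ha).1.le
  · exact lowerTransform_extendBy hL hlip (fun a ha => (hbd a ha).2.le) hαpos hsep hlam hx
end

section
/- Explicit transforms of the sign function: Let f : ℝ → ℝ be defined by f(x) = 1 for x > 0, f(x) = −1 for x < 0, and f(0) = 0. Then for every λ > 0: (a) C^l_λ(f)(x) = −1 for x ≤ 0, C^l_λ(f)(x) = 1 − λ(x − √(2/λ))² for 0 ≤ x ≤ √(2/λ), and C^l_λ(f)(x) = 1 for x ≥ √(2/λ); (b) C^u_λ(f)(x) = −1 for x ≤ −√(2/λ), C^u_λ(f)(x) = λ(x + √(2/λ))² − 1 for −√(2/λ) ≤ x ≤ 0, and C^u_λ(f)(x) = 1 for x ≥ 0; (c) consequently, (C^l_λ(f)(x)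 + C^u_λ(f)(x))/2 equals −1 for x ≤ −√(2/λ), equals (λ/2)(x + √(2/λ))² − 1 for −√(2/λ) ≤ x ≤ 0, equals 1 − (λ/2)(x − √(2/λ))² for 0 ≤ x ≤ √(2/λ), and equals 1 for x ≥ √(2/λ). -/
open Metric Set

variable {E : Type*}

/-- On `ℝ`, the convex envelope at `x` equals `b` as soon as some affine minorant takes the value
`b` at `x` and no affine minorant exceeds `b` there. -/
theorem convEnv_real_eq {g : ℝ → ℝ} {x b a : ℝ} (hmin : ∀ y, b + a * (y - x) ≤ g y)
    (hmax : ∀ c d : ℝ, (∀ y, c + d * y ≤ g y) → c + d * x ≤ b) : convEnv g x = b := by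
  refine IsGreatest.csSup_eq ⟨⟨AffineMap.lineMap (b - a * x) (b - a * x + a), ?_, ?_⟩, ?_⟩
  · intro y
    have h := hmin y
    simp only [AffineMap.lineMap_apply, vsub_eq_sub, vadd_eq_add, smul_eq_mul]
    linarith
  · simp only [AffineMap.lineMap_apply, vsub_eq_sub, vadd_eq_add, smul_eq_mul]
    ring
  · rintro v ⟨l, hl, rfl⟩
    have hlin (y : ℝ) : l y = l 0 + l.linear 1 * y := by
      have h := l.map_vadd 0 y
      have hy : l.linear y = y * l.linear 1 := by
        simpa using l.linear.map_smul y 1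
      simp only [vadd_eq_add, add_zero] at h
      rw [h, hy]
      ring
    rw [hlin x]
    exact hmax _ _ fun y => hlin y ▸ hl y

theorem convEnv_comp_neg (g : ℝ → ℝ) (x : ℝ) :
    convEnv (fun y => g (-y)) x = convEnv g (-x) := by
  unfold convEnv
  congr 1
  ext v
  constructor
  · rintro ⟨l, hl, rfl⟩
    refine ⟨l.comp (-AffineMap.id ℝ ℝ), fun y => ?_, ?_⟩
    · simpa using hl (-y)
    · simp
  · rintro ⟨l, hl, rfl⟩
    refine ⟨l.comp (-AffineMap.id ℝ ℝ), fun y => ?_, ?_⟩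
    · simpa using hl (-y)
    · simp

/-- For an odd function the upper transform is the odd reflection of the lower transform. -/
theorem upperTransform_of_odd {f : ℝ → ℝ} (hf : ∀ x, f (-x) = -f x) (lam x : ℝ) :
    upperTransform lam f x = -lowerTransform lam f (-x) := by
  have h := convEnv_comp_neg (fun y => lam * ‖y‖ ^ 2 + f y) x
  simp only [norm_neg, hf, ← sub_eq_add_neg] at h
  simp only [upperTransform, lowerTransform, norm_neg, h]
  ring

/-- The lower transform of the sign function. -/
theorem lowerTransform_sign {f : ℝ → ℝ}
    (hf : ∀ x : ℝ, f x = if 0 < x then 1 else if x < 0 then -1 else 0)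
    {lam : ℝ} (hlam : 0 < lam) (x : ℝ) :
    (x ≤ 0 → lowerTransform lam f x = -1) ∧
    (0 ≤ x → x ≤ Real.sqrt (2 / lam) →
      lowerTransform lam f x = 1 - lam * (x - Real.sqrt (2 / lam)) ^ 2) ∧
    (Real.sqrt (2 / lam) ≤ x → lowerTransform lam f x = 1) := by
  have hs : 0 < Real.sqrt (2 / lam) := Real.sqrt_pos.2 (by positivity)
  have hs2 : lam * Real.sqrt (2 / lam) ^ 2 = 2 := by
    rw [Real.sq_sqrt (by positivity)]
    field_simp
  set s := Real.sqrt (2 / lam)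
  have hpos {y : ℝ} (hy : 0 < y) : f y = 1 := by simp [hf, hy]
  have hneg {y : ℝ} (hy : y < 0) : f y = -1 := by simp [hf, hy, hy.le]
  have hge (y : ℝ) : -1 ≤ f y := by
    rw [hf]
    split_ifs <;> norm_num
  have hzero {c d : ℝ} (h : ∀ y, c + d * y ≤ lam * ‖y‖ ^ 2 + f y) : c ≤ -1 := by
    have hc : ContinuousWithinAt (fun y : ℝ => c + d * y) (Iio 0) 0 := by fun_prop
    have hg : ContinuousWithinAt (fun y : ℝ => lam * y ^ 2 - 1) (Iio 0) 0 := by fun_prop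
    have hle := le_of_tendsto_of_tendsto hc hg (by
      filter_upwards [self_mem_nhdsWithin] with y hy
      have h' := h y
      rw [hneg hy, Real.norm_eq_abs, sq_abs] at h'
      linarith)
    simpa using hle
  unfold lowerTransform
  refine ⟨fun hx => ?_, fun hx hxs => ?_, fun hx => ?_⟩
  · rw [convEnv_real_eq (b := lam * x ^ 2 - 1) (a := 2 * lam * x)]
    · rw [Real.norm_eq_abs, sq_abs]
      ring
    · intro y
      rw [Real.norm_eq_abs, sq_abs]
      nlinarith [hge y, mul_nonneg hlam.le (sq_nonneg (y - x))]
    · intro c d h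
      rcases hx.eq_or_lt with rfl | hx
      · have := hzero h
        linarith
      · have := h x
        rw [hneg hx, Real.norm_eq_abs, sq_abs] at this
        linarith
  · rw [convEnv_real_eq (b := -1 + 2 * lam * s * x) (a := 2 * lam * s)]
    · rw [Real.norm_eq_abs, sq_abs]
      linear_combination hs2
    · intro y
      rw [Real.norm_eq_abs, sq_abs]
      rcases le_or_gt y 0 with hy | hy
      · nlinarith [hge y, mul_nonneg hlam.le (sq_nonneg y),
          mul_nonneg (mul_pos hlam hs).le (neg_nonneg.2 hy)]
      · rw [hpos hy]
        nlinarith [mul_nonneg hlam.le (sq_nonneg (y - s))]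
    · intro c d h
      have h0 := hzero h
      have h1 := h s
      rw [hpos hs, Real.norm_eq_abs, sq_abs] at h1
      refine le_of_mul_le_mul_left ?_ hs
      have h2 := mul_le_mul_of_nonneg_left h0 (sub_nonneg.2 hxs)
      have h3 := mul_le_mul_of_nonneg_left h1 hx
      linear_combination h2 + h3 - x * hs2
  · rw [convEnv_real_eq (b := lam * x ^ 2 + 1) (a := 2 * lam * x)]
    · rw [Real.norm_eq_abs, sq_abs]
      ring
    · intro y
      rw [Real.norm_eq_abs, sq_abs]
      rcases le_or_gt y 0 with hy | hy
      · have h1 : s ^ 2 ≤ (x - y) ^ 2 := pow_le_pow_left₀ hs.le (by linarith) 2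
        nlinarith [hge y, mul_le_mul_of_nonneg_left h1 hlam.le]
      · rw [hpos hy]
        nlinarith [mul_nonneg hlam.le (sq_nonneg (y - x))]
    · intro c d h
      have := h x
      rwa [hpos (hs.trans_le hx), Real.norm_eq_abs, sq_abs] at this

/-- **Explicit transforms of the sign function.** For the sign function on `ℝ` and any `λ > 0`,
the lower transform, the upper transform and their average are given by the explicit piecewise
formulas below. -/
theorem transforms_sign_function (f : ℝ → ℝ)
    (hf : ∀ x : ℝ, f x = if 0 < x then 1 else if x < 0 then -1 else 0)
    (lam : ℝ) (hlam : 0 < lam) :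
    (∀ x : ℝ,
      (x ≤ 0 → lowerTransform lam f x = -1) ∧
      (0 ≤ x → x ≤ Real.sqrt (2 / lam) →
        lowerTransform lam f x = 1 - lam * (x - Real.sqrt (2 / lam)) ^ 2) ∧
      (Real.sqrt (2 / lam) ≤ x → lowerTransform lam f x = 1)) ∧
    (∀ x : ℝ,
      (x ≤ -Real.sqrt (2 / lam) → upperTransform lam f x = -1) ∧
      (-Real.sqrt (2 / lam) ≤ x → x ≤ 0 →
        upperTransform lam f x = lam * (x + Real.sqrt (2 / lam)) ^ 2 - 1) ∧
      (0 ≤ x → upperTransform lam f x = 1)) ∧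
    (∀ x : ℝ,
      (x ≤ -Real.sqrt (2 / lam) →
        (lowerTransform lam f x + upperTransform lam f x) / 2 = -1) ∧
      (-Real.sqrt (2 / lam) ≤ x → x ≤ 0 →
        (lowerTransform lam f x + upperTransform lam f x) / 2 =
          lam / 2 * (x + Real.sqrt (2 / lam)) ^ 2 - 1) ∧
      (0 ≤ x → x ≤ Real.sqrt (2 / lam) →
        (lowerTransform lam f x + upperTransform lam f x) / 2 =
          1 - lam / 2 * (x - Real.sqrt (2 / lam)) ^ 2) ∧
      (Real.sqrt (2 / lam) ≤ x →
        (lowerTransform lam f x + upperTransform lam f x) / 2 = 1)) := by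
  have hodd (x : ℝ) : f (-x) = -f x := by
    rcases lt_trichotomy x 0 with h | rfl | h
    · simp [hf, h, h.not_gt]
    · simp [hf]
    · simp [hf, h, h.not_gt]
  have hs := Real.sqrt_nonneg (2 / lam)
  have hL := lowerTransform_sign hf hlam
  have hU (x : ℝ) :
      (x ≤ -Real.sqrt (2 / lam) → upperTransform lam f x = -1) ∧
      (-Real.sqrt (2 / lam) ≤ x → x ≤ 0 →
        upperTransform lam f x = lam * (x + Real.sqrt (2 / lam)) ^ 2 - 1) ∧
      (0 ≤ x → upperTransform lam f x = 1) := by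
    rw [upperTransform_of_odd hodd]
    obtain ⟨h1, h2, h3⟩ := hL (-x)
    refine ⟨fun hx => ?_, fun hx hx0 => ?_, fun hx => ?_⟩
    · rw [h3 (by linarith)]
    · rw [h2 (by linarith) (by linarith)]
      ring
    · rw [h1 (by linarith)]
      ring
  refine ⟨hL, hU, fun x => ?_⟩
  obtain ⟨l1, l2, l3⟩ := hL x
  obtain ⟨u1, u2, u3⟩ := hU x
  refine ⟨fun hx => ?_, fun hx hx0 => ?_, fun hx0 hx => ?_, fun hx => ?_⟩
  · rw [l1 (by linarith), u1 hx]
    norm_num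
  · rw [l1 hx0, u2 hx hx0]
    ring
  · rw [l2 hx0 hx, u3 hx0]
    ring
  · rw [l3 hx, u3 (by linarith)]
    norm_num
end

section
/- Average approximation for data on two crossing lines with quadratic values: In ℝ², let K = ℓ_− ∪ ℓ_+, where ℓ_− = {(t, t) : t ∈ ℝ} and ℓ_+ = {(t, −t) : t ∈ ℝ}, and define f : K → ℝ by f(t, t) = −t² and f(t, −t) = t² (so f(0,0) = 0). Then for every λ ≥ 1/2 and every (x, y) ∈ ℝ² (note co[K] = ℝ²), the average approximation satisfies A^∞_λ(f_K)(x, y) = −xy. -/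
open Metric Set

variable {E : Type*}

/-- `Einf lam f K x`: value at `x` of the convex envelope of the function equal to
`f + lam‖·‖²` on `K` and `+∞` off `K`, expressed as an infimum over finite convex
combinations of points of `K`. -/
noncomputable def Einf [NormedAddCommGroup E] [NormedSpace ℝ E]
    (lam : ℝ) (f : E → ℝ) (K : Set E) (x : E) : ℝ :=
  sInf {v : ℝ | ∃ (k : ℕ) (μ : Fin k → ℝ) (p : Fin k → E),
    (∀ i, 0 ≤ μ i) ∧ (∀ i, p i ∈ K) ∧ (∑ i, μ i) = 1 ∧ (∑ i, μ i • p i) = x ∧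
    v = ∑ i, μ i * (f (p i) + lam * ‖p i‖ ^ 2)}

/-- Lower compensated convex transform `C^l_λ(f_K^{+∞})`. -/
noncomputable def lowerInf [NormedAddCommGroup E] [NormedSpace ℝ E]
    (lam : ℝ) (f : E → ℝ) (K : Set E) (x : E) : ℝ :=
  Einf lam f K x - lam * ‖x‖ ^ 2

/-- Upper compensated convex transform `C^u_λ(f_K^{−∞})`. -/
noncomputable def upperInf [NormedAddCommGroup E] [NormedSpace ℝ E]
    (lam : ℝ) (f : E → ℝ) (K : Set E) (x : E) : ℝ :=
  lam * ‖x‖ ^ 2 - Einf lam (fun y => -f y) K x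

/-- Average approximation `A^∞_λ(f_K)`. -/
noncomputable def avgInf [NormedAddCommGroup E] [NormedSpace ℝ E]
    (lam : ℝ) (f : E → ℝ) (K : Set E) (x : E) : ℝ :=
  (lowerInf lam f K x + upperInf lam f K x) / 2

/-- If `f + lam‖·‖²` equals `A² t²` at `(t, t)` and `B² t²` at `(t, -t)`, then its convex envelope
is the square of a weighted `ℓ¹` norm in the coordinates along the two lines. -/
theorem Einf_crossing_lines (f : EuclideanSpace ℝ (Fin 2) → ℝ) (lam A B : ℝ)
    (hA : 0 ≤ A) (hB : 0 ≤ B)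
    (h1 : ∀ p : EuclideanSpace ℝ (Fin 2), p 1 = p 0 → f p + lam * ‖p‖ ^ 2 = (A * p 0) ^ 2)
    (h2 : ∀ p : EuclideanSpace ℝ (Fin 2), p 1 = -p 0 → f p + lam * ‖p‖ ^ 2 = (B * p 0) ^ 2)
    (x : EuclideanSpace ℝ (Fin 2)) :
    Einf lam f ({p : EuclideanSpace ℝ (Fin 2) | p 1 = p 0} ∪
      {p : EuclideanSpace ℝ (Fin 2) | p 1 = -p 0}) x =
      (A * |(x 0 + x 1) / 2| + B * |(x 0 - x 1) / 2|) ^ 2 := by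
  set u := (x 0 + x 1) / 2 with hu
  set v := (x 0 - x 1) / 2 with hv
  set m := A * |u| + B * |v| with hm
  have hm0 : 0 ≤ m := by positivity
  obtain ⟨s, hs, hsu⟩ : ∃ s : ℝ, |s| ≤ 1 ∧ s * u = |u| := by
    rcases abs_cases u with ⟨h, -⟩ | ⟨h, -⟩
    · exact ⟨1, by norm_num, by linarith⟩
    · exact ⟨-1, by norm_num, by linarith⟩
  obtain ⟨r, hr, hrv⟩ : ∃ r : ℝ, |r| ≤ 1 ∧ r * v = |v| := by
    rcases abs_cases v with ⟨h, -⟩ | ⟨h, -⟩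
    · exact ⟨1, by norm_num, by linarith⟩
    · exact ⟨-1, by norm_num, by linarith⟩
  have key : ∀ c t C : ℝ, |c| ≤ 1 → 2 * m * (c * (C * t)) - m ^ 2 ≤ (C * t) ^ 2 := by
    intro c t C hc
    have hc2 : c ^ 2 ≤ 1 := (sq_le_one_iff_abs_le_one c).2 hc
    nlinarith [sq_nonneg (m * c - C * t), mul_nonneg (sq_nonneg m) (sub_nonneg.2 hc2)]
  have lower : ∀ w ∈ {w : ℝ | ∃ (k : ℕ) (μ : Fin k → ℝ) (p : Fin k → EuclideanSpace ℝ (Fin 2)),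
      (∀ i, 0 ≤ μ i) ∧ (∀ i, p i ∈ ({p : EuclideanSpace ℝ (Fin 2) | p 1 = p 0} ∪
      {p : EuclideanSpace ℝ (Fin 2) | p 1 = -p 0})) ∧ (∑ i, μ i) = 1 ∧ (∑ i, μ i • p i) = x ∧
      w = ∑ i, μ i * (f (p i) + lam * ‖p i‖ ^ 2)}, m ^ 2 ≤ w := by
    rintro w ⟨k, μ, p, hμ, hp, hsum, hx, rfl⟩
    have hx0 : ∑ i, μ i * p i 0 = x 0 := by rw [← hx]; simp
    have hx1 : ∑ i, μ i * p i 1 = x 1 := by rw [← hx]; simp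
    calc m ^ 2 = (m * (A * s + B * r)) * x 0 + (m * (A * s - B * r)) * x 1 - m ^ 2 * 1 := by
          have : A * (s * u) + B * (r * v) = m := by rw [hsu, hrv]
          rw [hu, hv] at this
          linear_combination (-2 * m) * this
      _ = ∑ i, μ i * ((m * (A * s + B * r)) * p i 0 + (m * (A * s - B * r)) * p i 1 - m ^ 2) := by
          rw [← hx0, ← hx1, ← hsum, Finset.mul_sum, Finset.mul_sum, Finset.mul_sum,
            ← Finset.sum_add_distrib, ← Finset.sum_sub_distrib]
          exact Finset.sum_congr rfl fun i _ => by ring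
      _ ≤ _ := by
          refine Finset.sum_le_sum fun i _ => mul_le_mul_of_nonneg_left ?_ (hμ i)
          rcases hp i with h | h <;> simp only [mem_ofPred_eq] at h
          · rw [h1 _ h, h]
            linarith [key s (p i 0) A hs]
          · rw [h2 _ h, h]
            linarith [key r (p i 0) B hr]
  have upper : ∀ δ : ℝ, 0 < δ → ∃ w ∈ {w : ℝ | ∃ (k : ℕ) (μ : Fin k → ℝ)
      (p : Fin k → EuclideanSpace ℝ (Fin 2)),
      (∀ i, 0 ≤ μ i) ∧ (∀ i, p i ∈ ({p : EuclideanSpace ℝ (Fin 2) | p 1 = p 0} ∪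
      {p : EuclideanSpace ℝ (Fin 2) | p 1 = -p 0})) ∧ (∑ i, μ i) = 1 ∧ (∑ i, μ i • p i) = x ∧
      w = ∑ i, μ i * (f (p i) + lam * ‖p i‖ ^ 2)}, w ≤ (m + 2 * δ) * m := by
    intro δ hδ
    set a := A * |u| + δ with ha
    set b := B * |v| + δ with hb
    have ha0 : 0 < a := by positivity
    have hb0 : 0 < b := by positivity
    have hab : a + b = m + 2 * δ := by rw [ha, hb, hm]; ring
    have hab0 : 0 < a + b := by positivity
    have bound : ∀ C t : ℝ, 0 ≤ C → (C * t) ^ 2 / (C * |t| + δ) ≤ C * |t| := by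
      intro C t hC
      have h0 : 0 ≤ C * |t| := by positivity
      rw [div_le_iff₀ (by positivity), mul_pow, ← sq_abs t]
      nlinarith [mul_nonneg h0 hδ.le]
    refine ⟨_, ⟨2, ![a / (a + b), b / (a + b)],
      ![!₂[u * (a + b) / a, u * (a + b) / a], !₂[v * (a + b) / b, -(v * (a + b) / b)]],
      ?_, ?_, ?_, ?_, rfl⟩, ?_⟩
    · intro i; fin_cases i <;> simp <;> positivity
    · intro i; fin_cases i <;> simp
    · simp [Fin.sum_univ_two]; field_simp
    · ext i
      fin_cases i <;> simp [Fin.sum_univ_two] <;> field_simp <;> simp only [hu, hv] <;> ring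
    · rw [Fin.sum_univ_two]
      simp only [Matrix.cons_val_zero, Matrix.cons_val_one]
      rw [h1 _ (by simp), h2 _ (by simp)]
      calc _ = (a + b) * ((A * u) ^ 2 / a + (B * v) ^ 2 / b) := by simp; field_simp
        _ ≤ (a + b) * (A * |u| + B * |v|) :=
          mul_le_mul_of_nonneg_left (add_le_add (bound A u hA) (bound B v hB)) hab0.le
        _ = _ := by rw [hab]
  refine le_antisymm (le_of_forall_pos_le_add fun ε hε => ?_) ?_
  · obtain ⟨w, hw, hle⟩ := upper (ε / (2 * (m + 1))) (by positivity)
    refine (csInf_le ⟨m ^ 2, lower⟩ hw).trans (hle.trans ?_)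
    have : 2 * (ε / (2 * (m + 1))) * m = ε * (m / (m + 1)) := by field_simp
    have h' : m / (m + 1) ≤ 1 := (div_le_one (by positivity)).2 (by linarith)
    nlinarith
  · obtain ⟨w, hw, -⟩ := upper 1 one_pos
    exact le_csInf ⟨w, hw⟩ lower

/-- **Average approximation for data on two crossing lines with quadratic values.**
In `ℝ²`, with `K = {y = x} ∪ {y = −x}` and `f(t,t) = −t²`, `f(t,−t) = t²`, one has
`A^∞_λ(f_K)(x,y) = −xy` for every `λ ≥ 1/2` and every `(x,y) ∈ ℝ² = co[K]`. -/
theorem avg_approx_crossing_lines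
    (K : Set (EuclideanSpace ℝ (Fin 2)))
    (hK : K = {p : EuclideanSpace ℝ (Fin 2) | p 1 = p 0} ∪
      {p : EuclideanSpace ℝ (Fin 2) | p 1 = -p 0})
    (f : EuclideanSpace ℝ (Fin 2) → ℝ)
    (hf1 : ∀ p : EuclideanSpace ℝ (Fin 2), p 1 = p 0 → f p = -(p 0) ^ 2)
    (hf2 : ∀ p : EuclideanSpace ℝ (Fin 2), p 1 = -p 0 → f p = (p 0) ^ 2)
    (lam : ℝ) (hlam : 1 / 2 ≤ lam) :
    ∀ p : EuclideanSpace ℝ (Fin 2), avgInf lam f K p = -(p 0 * p 1) := by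
  intro p
  have hnorm (q : EuclideanSpace ℝ (Fin 2)) : ‖q‖ ^ 2 = q 0 ^ 2 + q 1 ^ 2 := by
    rw [EuclideanSpace.real_norm_sq_eq, Fin.sum_univ_two]
  have ha : √(2 * lam - 1) ^ 2 = 2 * lam - 1 := Real.sq_sqrt (by linarith)
  have hb : √(2 * lam + 1) ^ 2 = 2 * lam + 1 := Real.sq_sqrt (by linarith)
  have lo := Einf_crossing_lines f lam _ _ (Real.sqrt_nonneg (2 * lam - 1))
    (Real.sqrt_nonneg (2 * lam + 1))
    (fun q hq => by rw [hf1 q hq, hnorm, hq, mul_pow, ha]; ring)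
    (fun q hq => by rw [hf2 q hq, hnorm, hq, mul_pow, hb]; ring) p
  have up := Einf_crossing_lines (fun y => -f y) lam _ _ (Real.sqrt_nonneg (2 * lam + 1))
    (Real.sqrt_nonneg (2 * lam - 1))
    (fun q hq => by rw [hf1 q hq, hnorm, hq, mul_pow, hb]; ring)
    (fun q hq => by rw [hf2 q hq, hnorm, hq, mul_pow, ha]; ring) p
  rw [avgInf, lowerInf, upperInf, hK, lo, up]
  have hu := sq_abs ((p 0 + p 1) / 2)
  have hv := sq_abs ((p 0 - p 1) / 2)
  generalize |(p 0 + p 1) / 2| = U at *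
  generalize |(p 0 - p 1) / 2| = V at *
  linear_combination (U ^ 2 - V ^ 2) / 2 * (ha - hb) - hu + hv
end
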